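/- arXiv:1007.4431 — 2 statements merged into one kernel-verified Lean document; each statement's English description precedes it below -/
import Mathlib

section
/- Discrete orthogonality of antisymmetric orbit functions of A_2: Let M be a positive integer and let k, l, k', l' be positive integers with k + l ≤ M − 1 and k' + l' ≤ M − 1. Then the sum over all pairs of positive integers (s₁, s₂) with s₁ + s₂ ≤ M − 1 of S_{(k,l)}(x(s₁,s₂)) · conj(S_{(k',l')}(x(s₁,s₂))) equals 3M² if (k,l) = (k',l') and equals 0 otherwise. -/
/-- `e t = exp(2πi t)` -/
noncomputable def e (t : ℝ) : ℂ := Complex.exp (2 * Real.pi * Complex.I * t)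

/-- The antisymmetric orbit function `S_{(k,l)}` of `A₂`, the signed sum over the
Weyl group orbit of the dominant weight `(k,l)` written in the basis of fundamental weights. -/
noncomputable def SA2 (k l : ℕ) (t₁ t₂ : ℝ) : ℂ :=
  e ((k : ℝ) * t₁ + l * t₂) - e (-(k : ℝ) * t₁ + ((k : ℝ) + l) * t₂)
    - e (((k : ℝ) + l) * t₁ - l * t₂) + e (-((k : ℝ) + l) * t₁ + k * t₂)
    + e ((l : ℝ) * t₁ - ((k : ℝ) + l) * t₂) - e (-(l : ℝ) * t₁ - k * t₂)

/-- `E M n = e(n/(3M))`. -/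
noncomputable def EE (M : ℕ) (n : ℤ) : ℂ := e ((n : ℝ) / (3 * M))

def wA (k l : ℤ) : Fin 6 → ℤ := ![k, -k, k + l, -(k + l), l, -l]
def wB (k l : ℤ) : Fin 6 → ℤ := ![l, k + l, -l, k, -(k + l), -k]
def wS : Fin 6 → ℤ := ![1, -1, -1, 1, 1, -1]

/-- The orbit function on the integer grid. -/
noncomputable def TT (M : ℕ) (k l : ℤ) (x y : ℤ) : ℂ :=
  ∑ i : Fin 6, (wS i : ℂ) *
    EE M ((2 * wA k l i + wB k l i) * x + (wA k l i + 2 * wB k l i) * y)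

lemma EE_add (M : ℕ) (m n : ℤ) : EE M (m + n) = EE M m * EE M n := by
  unfold EE e
  rw [← Complex.exp_add]
  congr 1
  push_cast
  ring

lemma EE_zero (M : ℕ) : EE M 0 = 1 := by simp [EE, e]

lemma EE_conj (M : ℕ) (n : ℤ) : (starRingEnd ℂ) (EE M n) = EE M (-n) := by
  unfold EE e
  rw [← Complex.exp_conj]
  congr 1
  simp only [map_mul, Complex.conj_I, Complex.conj_ofReal, map_ofNat]
  push_cast
  ring

lemma EE_eq_one_iff (M : ℕ) (hM : 0 < M) (n : ℤ) : EE M n = 1 ↔ (3 * (M : ℤ)) ∣ n := by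
  unfold EE e
  rw [Complex.exp_eq_one_iff]
  have hM' : (M : ℂ) ≠ 0 := by exact_mod_cast hM.ne'
  have hpi : (2 * Real.pi * Complex.I : ℂ) ≠ 0 := Complex.two_pi_I_ne_zero
  constructor
  · rintro ⟨c, hc⟩
    refine ⟨c, ?_⟩
    rw [mul_comm (c : ℂ)] at hc
    have h := mul_left_cancel₀ hpi hc
    push_cast at h
    rw [div_eq_iff (by simpa using hM')] at h
    have h2 : (n : ℂ) = ((3 * (M : ℤ) * c : ℤ) : ℂ) := by
      push_cast; rw [h]; ring
    exact_mod_cast h2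
  · rintro ⟨c, rfl⟩
    refine ⟨c, ?_⟩
    push_cast
    field_simp

lemma EE_congr (M : ℕ) (hM : 0 < M) (m n c : ℤ) (h : m = n + 3 * (M : ℤ) * c) :
    EE M m = EE M n := by
  rw [h, EE_add, (EE_eq_one_iff M hM _).2 ⟨c, rfl⟩, mul_one]

lemma EE_pow (M : ℕ) (n : ℤ) (s : ℕ) : EE M (n * s) = EE M n ^ s := by
  induction s with
  | zero => simp [EE_zero]
  | succ s ih =>
    rw [pow_succ, ← ih, ← EE_add]
    congr 1
    push_cast
    ring

lemma EE_sum (M : ℕ) (hM : 0 < M) (N : ℕ) (n : ℤ) (h : 3 * (M : ℤ) ∣ n * N) :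
    ∑ s ∈ Finset.range N, EE M (n * s) = if 3 * (M : ℤ) ∣ n then (N : ℂ) else 0 := by
  simp only [EE_pow]
  split_ifs with h1
  · rw [(EE_eq_one_iff M hM n).2 h1]
    simp
  · have h2 : EE M n ≠ 1 := fun h3 => h1 ((EE_eq_one_iff M hM n).1 h3)
    rw [geom_sum_eq h2, ← EE_pow, (EE_eq_one_iff M hM _).2 h]
    simp

/-- Sum of a character over the rectangle `[0,3M) × [0,M)`. -/
lemma EE_rect (M : ℕ) (hM : 0 < M) (a b : ℤ) :
    ∑ x ∈ Finset.range (3 * M), ∑ y ∈ Finset.range M,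
      EE M ((2 * a + b) * x + (a + 2 * b) * y) =
      if 3 * (M : ℤ) ∣ 2 * a + b ∧ (M : ℤ) ∣ a then 3 * (M : ℂ) ^ 2 else 0 := by
  simp only [EE_add, ← Finset.mul_sum]
  rw [← Finset.sum_mul, EE_sum M hM (3 * M) _ ⟨2 * a + b, by push_cast; ring⟩]
  by_cases h1 : 3 * (M : ℤ) ∣ 2 * a + b
  · obtain ⟨c, hc⟩ := h1
    have h2 : ∀ y : ℕ, EE M ((a + 2 * b) * y) = EE M ((-3 * a) * y) := by
      intro y
      refine EE_congr M hM _ _ (2 * c * y) ?_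
      linear_combination (2 * (y : ℤ)) * hc
    simp only [h2]
    rw [EE_sum M hM M _ ⟨-a, by ring⟩]
    have h3 : 3 * (M : ℤ) ∣ -3 * a ↔ (M : ℤ) ∣ a := by
      rw [show -3 * a = -(3 * a) by ring, dvd_neg]
      exact mul_dvd_mul_iff_left (by norm_num)
    have h4 : 3 * (M : ℤ) ∣ 2 * a + b := ⟨c, hc⟩
    simp only [h3, h4, true_and, if_true]
    split_ifs
    · push_cast; ring
    · simp
  · simp [h1]

lemma SA2_eq_TT (M k l s t : ℕ) :
    SA2 k l ((2 * (s : ℝ) + t) / (3 * M)) (((s : ℝ) + 2 * t) / (3 * M)) =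
      TT M k l s t := by
  unfold SA2 TT EE
  simp only [Fin.sum_univ_six, wS, wA, wB]
  simp only [Matrix.cons_val]
  push_cast
  simp only [one_mul, neg_mul, ← sub_eq_add_neg]
  have hh : ∀ a b c d f g a' b' c' d' f' g' : ℝ, a = a' → b = b' → c = c' → d = d' → f = f' →
      g = g' → e a - e b - e c + e d + e f - e g = e a' - e b' - e c' + e d' + e f' - e g' := by
    rintro _ _ _ _ _ _ _ _ _ _ _ _ rfl rfl rfl rfl rfl rfl; rfl
  apply hh <;> ring

lemma TT_r1 (M : ℕ) (k l x y : ℤ) : TT M k l (-x) (x + y) = - TT M k l x y := by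
  unfold TT
  simp only [Fin.sum_univ_six, wS, wA, wB]
  simp only [Matrix.cons_val]
  ring_nf

lemma TT_r2 (M : ℕ) (k l x y : ℤ) : TT M k l (x + y) (-y) = - TT M k l x y := by
  unfold TT
  simp only [Fin.sum_univ_six, wS, wA, wB]
  simp only [Matrix.cons_val]
  ring_nf

lemma TT_shift (M : ℕ) (hM : 0 < M) (k l x y u v : ℤ) :
    TT M k l (x + M * (2 * u - v)) (y + M * (2 * v - u)) = TT M k l x y := by
  unfold TT
  refine Finset.sum_congr rfl fun i _ => ?_
  congr 1
  refine EE_congr M hM _ _ (wA k l i * u + wB k l i * v) ?_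
  ring

lemma TT_refl (M : ℕ) (hM : 0 < M) (k l x y : ℤ) :
    TT M k l (M - y) (M - x) = - TT M k l x y := by
  rw [← TT_shift M hM k l (M - y) (M - x) (-1) (-1)]
  have h1 := TT_r1 M k l x y
  have h2 := TT_r2 M k l (-x) (x + y)
  have h3 := TT_r1 M k l (-x + (x + y)) (-(x + y))
  rw [h2, h1] at h3
  rw [neg_neg] at h3
  rw [← h3]
  congr 1 <;> ring

lemma TT_rot (M : ℕ) (hM : 0 < M) (k l x y : ℤ) :
    TT M k l (x + M) y = TT M k l (M - x - y) x := by
  have h1 := TT_r2 M k l (x + M) y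
  have h2 := TT_r1 M k l (x + M + y) (-y)
  rw [h1, neg_neg] at h2
  rw [← h2, ← TT_shift M hM k l (M - x - y) x (-1) 0]
  congr 1 <;> ring

lemma TT_rot2 (M : ℕ) (hM : 0 < M) (k l x y : ℤ) :
    TT M k l (x + 2 * M) y = TT M k l y (M - x - y) := by
  have h2 := TT_r1 M k l (x + 2 * M) y
  have h3 := TT_r2 M k l (-(x + 2 * M)) (x + 2 * M + y)
  rw [h2, neg_neg] at h3
  rw [← h3, ← TT_shift M hM k l y (M - x - y) (-1) (-2)]
  congr 1 <;> ring

lemma TT_wall1 (M : ℕ) (k l y : ℤ) : TT M k l 0 y = 0 := by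
  have h := TT_r1 M k l 0 y
  simp only [neg_zero, zero_add] at h
  exact self_eq_neg.1 h

lemma TT_wall2 (M : ℕ) (k l x : ℤ) : TT M k l x 0 = 0 := by
  have h := TT_r2 M k l x 0
  simp only [neg_zero, add_zero] at h
  exact self_eq_neg.1 h

lemma TT_wall3 (M : ℕ) (hM : 0 < M) (k l x y : ℤ) (hxy : x + y = M) : TT M k l x y = 0 := by
  have h := TT_refl M hM k l x y
  rw [show (M : ℤ) - y = x by omega, show (M : ℤ) - x = y by omega] at h
  exact self_eq_neg.1 h

lemma dvd_small (M d : ℤ) (hM : 0 < M) (h : M ∣ d) (h1 : d < 2 * M) (h2 : -(2 * M) < d) :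
    d = 0 ∨ d = M ∨ d = -M := by
  obtain ⟨c, rfl⟩ := h
  have h3 : c < 2 := by nlinarith
  have h4 : -2 < c := by nlinarith
  have : c = -1 ∨ c = 0 ∨ c = 1 := by omega
  rcases this with rfl | rfl | rfl <;> simp

lemma weights_ne (M k l k' l' : ℤ) (hk : 1 ≤ k) (hl : 1 ≤ l) (hk' : 1 ≤ k') (hl' : 1 ≤ l')
    (hkl : k + l < M) (hkl' : k' + l' < M) (i j : Fin 6) :
    (3 * M ∣ 2 * (wA k l i - wA k' l' j) + (wB k l i - wB k' l' j) ∧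
      M ∣ wA k l i - wA k' l' j) ↔ (i = j ∧ k = k' ∧ l = l') := by
  constructor
  · rintro ⟨h1, h2⟩
    have bd : ∀ k l : ℤ, 1 ≤ k → 1 ≤ l → k + l < M → ∀ i : Fin 6,
        (-M < wA k l i ∧ wA k l i < M) ∧
        (-(2 * M) < 2 * wA k l i + wB k l i ∧ 2 * wA k l i + wB k l i < 2 * M) := by
      intro k l hk hl hkl i
      fin_cases i <;> simp [wA, wB] <;> omega
    obtain ⟨⟨a1, a2⟩, a3, a4⟩ := bd k l hk hl hkl i
    obtain ⟨⟨b1, b2⟩, b3, b4⟩ := bd k' l' hk' hl' hkl' j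
    have c1 := dvd_small _ _ (by omega) h1 (by omega) (by omega)
    have c2 := dvd_small _ _ (by omega) h2 (by omega) (by omega)
    clear h1 h2 bd a1 a2 a3 a4 b1 b2 b3 b4
    fin_cases i <;> fin_cases j <;> simp [wA, wB] at c1 c2 ⊢ <;> omega
  · rintro ⟨rfl, rfl, rfl⟩
    simp

/-- The sum over the rectangle. -/
lemma TT_rect (M k l k' l' : ℕ) (hM : 0 < M)
    (hk : 1 ≤ k) (hl : 1 ≤ l) (hk' : 1 ≤ k') (hl' : 1 ≤ l')
    (hkl : k + l < M) (hkl' : k' + l' < M) :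
    ∑ x ∈ Finset.range (3 * M), ∑ y ∈ Finset.range M,
      TT M k l x y * (starRingEnd ℂ) (TT M k' l' x y) =
    6 * if (k, l) = (k', l') then 3 * (M : ℂ) ^ 2 else 0 := by
  have h1 : ∀ x y : ℤ, TT M k l x y * (starRingEnd ℂ) (TT M k' l' x y) =
      ∑ i : Fin 6, ∑ j : Fin 6, ((wS i : ℂ) * (wS j : ℂ)) *
        EE M ((2 * (wA k l i - wA k' l' j) + (wB k l i - wB k' l' j)) * x +
          ((wA k l i - wA k' l' j) + 2 * (wB k l i - wB k' l' j)) * y) := by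
    intro x y
    unfold TT
    rw [map_sum, Finset.sum_mul_sum]
    refine Finset.sum_congr rfl fun i _ => Finset.sum_congr rfl fun j _ => ?_
    rw [map_mul, EE_conj, map_intCast, mul_mul_mul_comm, ← EE_add]
    congr 2
    ring
  simp only [h1]
  have h2 : ∀ f : Fin 6 → Fin 6 → ℕ → ℕ → ℂ,
      ∑ x ∈ Finset.range (3 * M), ∑ y ∈ Finset.range M, ∑ i, ∑ j, f i j x y =
      ∑ i, ∑ j, ∑ x ∈ Finset.range (3 * M), ∑ y ∈ Finset.range M, f i j x y := by
    intro f
    simp only [Finset.sum_comm (s := Finset.range M) (t := Finset.univ)]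
    simp only [Finset.sum_comm (s := Finset.range (3 * M)) (t := Finset.univ)]
  rw [h2]
  simp only [← Finset.mul_sum, EE_rect M hM]
  simp only [weights_ne (M : ℤ) k l k' l' (by omega) (by omega) (by omega) (by omega)
    (by omega) (by omega)]
  have h3 : ∀ i, wS i * wS i = 1 := by decide
  have h4 : ∀ i, (wS i : ℂ) * wS i = 1 := by
    intro i; exact_mod_cast h3 i
  by_cases h : k = k' ∧ l = l'
  · obtain ⟨rfl, rfl⟩ := h
    simp [h4]
  · have h' : (k : ℤ) = k' → ¬ (l : ℤ) = l' := by
      intro h5 h6; exact h ⟨by omega, by omega⟩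
    have h'' : (k : ℤ) = k' ∧ (l : ℤ) = l' ↔ False := by
      constructor
      · rintro ⟨h5, h6⟩; exact h' h5 h6
      · exact False.elim
    simp [h'', h]

/-- Folding of the rectangle onto the fundamental alcove. -/
lemma fold_sum (M : ℕ) (F : ℤ → ℤ → ℂ)
    (hr1 : ∀ x y, F (-x) (x + y) = F x y) (hr2 : ∀ x y, F (x + y) (-y) = F x y)
    (hrefl : ∀ x y, F (M - y) (M - x) = F x y)
    (hrot : ∀ x y, F (x + M) y = F (M - x - y) x)
    (hrot2 : ∀ x y, F (x + 2 * M) y = F y (M - x - y))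
    (w1 : ∀ y, F 0 y = 0) (w2 : ∀ x, F x 0 = 0) (w3 : ∀ x y : ℤ, x + y = M → F x y = 0) :
    ∑ x ∈ Finset.range (3 * M), ∑ y ∈ Finset.range M, F x y =
    6 * ∑ p ∈ (Finset.range M ×ˢ Finset.range M).filter
        (fun p => 1 ≤ p.1 ∧ 1 ≤ p.2 ∧ p.1 + p.2 ≤ M - 1), F p.1 p.2 := by
  set T := (Finset.range M ×ˢ Finset.range M).filter
        (fun p => 1 ≤ p.1 ∧ 1 ≤ p.2 ∧ p.1 + p.2 ≤ M - 1) with hT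
  have hTm : ∀ p : ℕ × ℕ, p ∈ T ↔ 1 ≤ p.1 ∧ 1 ≤ p.2 ∧ p.1 + p.2 < M := by
    intro p
    simp only [hT, Finset.mem_filter, Finset.mem_product, Finset.mem_range]
    omega
  let H : ℕ × ℕ → ℂ := fun p => F p.1 p.2 + F (M - p.1 - p.2) p.1 + F p.2 (M - p.1 - p.2)
  have e1 : ∑ x ∈ Finset.range (3 * M), ∑ y ∈ Finset.range M, F x y =
      ∑ p ∈ Finset.range M ×ˢ Finset.range M, H p := by
    rw [show 3 * M = M + M + M by ring, Finset.sum_range_add, Finset.sum_range_add,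
      Finset.sum_product, ← Finset.sum_add_distrib, ← Finset.sum_add_distrib]
    refine Finset.sum_congr rfl fun x _ => ?_
    rw [← Finset.sum_add_distrib, ← Finset.sum_add_distrib]
    refine Finset.sum_congr rfl fun y _ => ?_
    simp only [H]
    rw [← hrot, ← hrot2]
    push_cast
    congr 2
    · congr 1; ring
    · ring
  have e2 : ∑ p ∈ (Finset.range M ×ˢ Finset.range M).filter (fun p => ¬ (p ∈ T)), H p =
      ∑ p ∈ T, H p := by
    have e3 : ∑ p ∈ (Finset.range M ×ˢ Finset.range M).filter (fun p => M < p.1 + p.2), H p =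
      ∑ p ∈ (Finset.range M ×ˢ Finset.range M).filter (fun p => ¬ (p ∈ T)), H p := by
      apply Finset.sum_subset
      · intro p
        simp only [Finset.mem_filter, Finset.mem_product, Finset.mem_range, hTm]
        omega
      · intro p
        simp only [Finset.mem_filter, Finset.mem_product, Finset.mem_range, hTm]
        rintro ⟨⟨h1, h2⟩, h3⟩ h4
        have h5 : p.1 = 0 ∨ p.2 = 0 ∨ p.1 + p.2 = M := by omega
        simp only [H]
        rcases h5 with h | h | h
        · rw [h]
          simp only [Nat.cast_zero]
          rw [w1, w2, w3 _ _ (by ring)]; simp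
        · rw [h]
          simp only [Nat.cast_zero]
          rw [w1, w2, w3 _ _ (by ring)]; simp
        · rw [show (M : ℤ) - p.1 - p.2 = 0 by omega]
          rw [w1, w2, w3 _ _ (by omega)]; simp
    rw [← e3]
    refine Finset.sum_nbij' (fun p => (M - p.2, M - p.1)) (fun p => (M - p.2, M - p.1))
      ?_ ?_ ?_ ?_ ?_
    · intro p
      simp only [Finset.mem_filter, Finset.mem_product, Finset.mem_range, hTm]
      omega
    · intro p
      simp only [Finset.mem_filter, Finset.mem_product, Finset.mem_range, hTm]
      omega
    · rintro ⟨a, b⟩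
      simp only [Finset.mem_filter, Finset.mem_product, Finset.mem_range, hTm, Prod.mk.injEq]
      omega
    · rintro ⟨a, b⟩
      simp only [hTm, Prod.mk.injEq]
      omega
    · rintro ⟨a, b⟩
      simp only [Finset.mem_filter, Finset.mem_product, Finset.mem_range]
      rintro ⟨⟨h1, h2⟩, h3⟩
      simp only [H]
      rw [Nat.cast_sub h2.le, Nat.cast_sub h1.le]
      rw [hrefl, ← hr1 ((M : ℤ) - a - b) a, ← hr2 b ((M : ℤ) - a - b)]
      ring_nf
  have e4 : ∑ p ∈ T, F (M - p.1 - p.2) p.1 = ∑ p ∈ T, F p.1 p.2 := by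
    refine Finset.sum_nbij' (fun p => (M - p.1 - p.2, p.1)) (fun p => (p.2, M - p.1 - p.2))
      ?_ ?_ ?_ ?_ ?_
    · intro p
      simp only [hTm]; omega
    · intro p
      simp only [hTm]; omega
    · rintro ⟨a, b⟩
      simp only [hTm, Prod.mk.injEq, true_and, and_true]; omega
    · rintro ⟨a, b⟩
      simp only [hTm, Prod.mk.injEq, true_and, and_true]; omega
    · rintro ⟨a, b⟩
      simp only [hTm]
      intro h
      rw [show ((M - a - b : ℕ) : ℤ) = M - a - b by omega]
  have e5 : ∑ p ∈ T, F p.2 (M - p.1 - p.2) = ∑ p ∈ T, F p.1 p.2 := by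
    refine Finset.sum_nbij' (fun p => (p.2, M - p.1 - p.2)) (fun p => (M - p.1 - p.2, p.1))
      ?_ ?_ ?_ ?_ ?_
    · intro p
      simp only [hTm]; omega
    · intro p
      simp only [hTm]; omega
    · rintro ⟨a, b⟩
      simp only [hTm, Prod.mk.injEq, true_and, and_true]; omega
    · rintro ⟨a, b⟩
      simp only [hTm, Prod.mk.injEq, true_and, and_true]; omega
    · rintro ⟨a, b⟩
      simp only [hTm]
      intro h
      rw [show ((M - a - b : ℕ) : ℤ) = M - a - b by omega]
  have e6 : (Finset.range M ×ˢ Finset.range M).filter (fun p => p ∈ T) = T := by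
    ext p
    simp only [Finset.mem_filter, Finset.mem_product, Finset.mem_range, hTm]
    omega
  rw [e1, ← Finset.sum_filter_add_sum_filter_not _ (fun p => p ∈ T), e2, e6]
  simp only [H, Finset.sum_add_distrib]
  rw [e4, e5]
  ring

/-- Discrete orthogonality of the antisymmetric orbit functions of `A₂` on the grid
`x(s₁,s₂) = ((2s₁+s₂)/(3M), (s₁+2s₂)/(3M))` with `s₁, s₂ ≥ 1` and `s₁ + s₂ ≤ M - 1`. -/
theorem discrete_orthogonality_SA2 (M k l k' l' : ℕ) (hM : 0 < M)
    (hk : 1 ≤ k) (hl : 1 ≤ l) (hk' : 1 ≤ k') (hl' : 1 ≤ l')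
    (hkl : k + l ≤ M - 1) (hkl' : k' + l' ≤ M - 1) :
    ∑ p ∈ (Finset.range M ×ˢ Finset.range M).filter
        (fun p => 1 ≤ p.1 ∧ 1 ≤ p.2 ∧ p.1 + p.2 ≤ M - 1),
      SA2 k l ((2 * (p.1 : ℝ) + p.2) / (3 * M)) (((p.1 : ℝ) + 2 * p.2) / (3 * M)) *
        (starRingEnd ℂ)
          (SA2 k' l' ((2 * (p.1 : ℝ) + p.2) / (3 * M)) (((p.1 : ℝ) + 2 * p.2) / (3 * M))) =
      if (k, l) = (k', l') then 3 * (M : ℂ) ^ 2 else 0 := by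
  have h := fold_sum M (fun x y => TT M k l x y * (starRingEnd ℂ) (TT M k' l' x y))
    (by intro x y; simp only [TT_r1]; simp)
    (by intro x y; simp only [TT_r2]; simp)
    (by intro x y; simp only [TT_refl M hM]; simp)
    (by intro x y; simp only [TT_rot M hM])
    (by intro x y; simp only [TT_rot2 M hM])
    (by intro y; simp only [TT_wall1, zero_mul])
    (by intro x; simp only [TT_wall2, zero_mul])
    (by intro x y hxy; simp only [TT_wall3 M hM _ _ x y hxy, zero_mul])
  rw [TT_rect M k l k' l' hM hk hl hk' hl' (by omega) (by omega)] at h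
  have h' := mul_left_cancel₀ (by norm_num : (6 : ℂ) ≠ 0) h
  simp only [SA2_eq_TT]
  exact h'.symm
end

section
/- Weight function of the orthogonal polynomials of B_3: For all x = (x₁,x₂,x₃) ∈ ℝ³, the product of 4·sin²(π⟨α,x⟩) over the nine positive roots α of B_3 (namely α = e_i − e_j and e_i + e_j for 1 ≤ i < j ≤ 3, and α = e_i for i = 1,2,3, with ⟨·,·⟩ the standard inner product) equals the absolute value of (16 + 4u₂ − u₃²)·(1728 + 1728u₁ + 432u₁² − 32u₁³ − 16u₁⁴ + 864u₂ + 576u₁u₂ + 72u₁²u₂ − 8u₁³u₂ + 108u₂² + 36u₁u₂² − u₁²u₂² + 4u₂³ − 432u₃² − 216u₁u₃² + 4u₁³u₃² − 108u₂u₃² − 18u₁u₂u₃² + 27u₃⁴), where u₁ = 2(cos 2πx₁ + cos 2πx₂ + cos 2πx₃), u₂ = 4(cos 2πx₁ cos 2πx₂ + cos 2πx₁ cos 2πx₃ + cos 2πx₂ cos 2πx₃), and u₃ = 8 cos πx₁ cos πx₂ cos πx₃. -/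
open Real

/-- Product over the two roots `e_i ± e_j`. -/
lemma B3_long_pair (a b : ℝ) :
    (4 * sin (π * (a - b)) ^ 2) * (4 * sin (π * (a + b)) ^ 2) =
      (2 * cos (2 * π * a) - 2 * cos (2 * π * b)) ^ 2 := by
  have h := cos_sub_cos (2 * π * a) (2 * π * b)
  have h1 : (2 * π * a + 2 * π * b) / 2 = π * (a + b) := by ring
  have h2 : (2 * π * a - 2 * π * b) / 2 = π * (a - b) := by ring
  rw [h1, h2] at h
  rw [← mul_sub, h]
  ring

/-- Short root factor in terms of `cos (2 π a)`. -/
lemma B3_short (a : ℝ) : 4 * sin (π * a) ^ 2 = 2 - 2 * cos (2 * π * a) := by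
  rw [mul_assoc 2 π a, cos_two_mul, sin_sq]
  ring

lemma B3_half (a : ℝ) : 4 * cos (π * a) ^ 2 = 2 + 2 * cos (2 * π * a) := by
  rw [mul_assoc 2 π a, cos_two_mul]
  ring

/-- Weight function of the orthogonal polynomials of `B₃`: the product of `4 sin²(π⟨α,x⟩)`
over the nine positive roots of `B₃` equals the absolute value of the stated polynomial in
the orbit functions `u₁, u₂, u₃` of the fundamental weights. -/
theorem B3_weight_function (x₁ x₂ x₃ u₁ u₂ u₃ : ℝ)
    (hu₁ : u₁ = 2 * (cos (2 * π * x₁) + cos (2 * π * x₂) + cos (2 * π * x₃)))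
    (hu₂ : u₂ = 4 * (cos (2 * π * x₁) * cos (2 * π * x₂) + cos (2 * π * x₁) * cos (2 * π * x₃)
      + cos (2 * π * x₂) * cos (2 * π * x₃)))
    (hu₃ : u₃ = 8 * cos (π * x₁) * cos (π * x₂) * cos (π * x₃)) :
    (4 * sin (π * (x₁ - x₂)) ^ 2) * (4 * sin (π * (x₁ + x₂)) ^ 2) *
    (4 * sin (π * (x₁ - x₃)) ^ 2) * (4 * sin (π * (x₁ + x₃)) ^ 2) *
    (4 * sin (π * (x₂ - x₃)) ^ 2) * (4 * sin (π * (x₂ + x₃)) ^ 2) *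
    (4 * sin (π * x₁) ^ 2) * (4 * sin (π * x₂) ^ 2) * (4 * sin (π * x₃) ^ 2) =
      |(16 + 4 * u₂ - u₃ ^ 2) *
        (1728 + 1728 * u₁ + 432 * u₁ ^ 2 - 32 * u₁ ^ 3 - 16 * u₁ ^ 4 + 864 * u₂
          + 576 * u₁ * u₂ + 72 * u₁ ^ 2 * u₂ - 8 * u₁ ^ 3 * u₂ + 108 * u₂ ^ 2
          + 36 * u₁ * u₂ ^ 2 - u₁ ^ 2 * u₂ ^ 2 + 4 * u₂ ^ 3 - 432 * u₃ ^ 2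
          - 216 * u₁ * u₃ ^ 2 + 4 * u₁ ^ 3 * u₃ ^ 2 - 108 * u₂ * u₃ ^ 2
          - 18 * u₁ * u₂ * u₃ ^ 2 + 27 * u₃ ^ 4)| := by
  have hL : ∀ a b c d e f g h i : ℝ, a * b * c * d * e * f * g * h * i =
      (a * b) * (c * d) * (e * f) * (g * h * i) := by intros; ring
  have hpos : (0 : ℝ) ≤ (4 * sin (π * x₁) ^ 2) * (4 * sin (π * x₂) ^ 2) *
      (4 * sin (π * x₃) ^ 2) := by positivity
  have hsq : u₃ ^ 2 = (4 * cos (π * x₁) ^ 2) * (4 * cos (π * x₂) ^ 2) *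
      (4 * cos (π * x₃) ^ 2) := by rw [hu₃]; ring
  have h4 : u₃ ^ 4 = (u₃ ^ 2) ^ 2 := by ring
  rw [hL, B3_long_pair, B3_long_pair, B3_long_pair, h4, hsq, hu₁, hu₂]
  simp only [B3_half]
  simp only [B3_short] at hpos ⊢
  generalize cos (2 * π * x₁) = a at *
  generalize cos (2 * π * x₂) = b at *
  generalize cos (2 * π * x₃) = c at *
  have hnn : 0 ≤ (2 * a - 2 * b) ^ 2 * (2 * a - 2 * c) ^ 2 * (2 * b - 2 * c) ^ 2 *
      ((2 - 2 * a) * (2 - 2 * b) * (2 - 2 * c)) := mul_nonneg (by positivity) hpos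
  rw [← abs_of_nonneg hnn, ← abs_neg]
  congr 1
  ring
end
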